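/- (Narrowing of entry transitions preserves unsafe evaluations; from the proof of Theorem 2.) Let P be a program, C ⊆ P, and let Q : L → (V → Prop) be a conditional inductive invariant for C. Let t_exit = (ℓ̃, τ_e, ℓ_e) ∈ P with t_exit ∉ C and φ : V → Prop satisfy: for all v, v', if Q ℓ̃ v and τ_e v v' then φ v'. Let t = (ℓ, τ, ℓ') ∈ P be an entry transition with Q ℓ' equal to the conjunction of finitely many literals L₁, …, L_k, and let S ⊆ {1, …, k} be such that P is safe for the assertion (t, Lᵢ) for every i ∈ S. Then for every evaluation of P starting at an initial state of the form (ℓ0, v₀) →_P^* (ℓ, v̄) →_t (ℓ', v₁) →_C^* (ℓ̃, v) →_{t_exit} (ℓ_e, v') with ¬ φ v', there exists i ∉ S with ¬ Lᵢ v₁ (i.e., the negation of the conjunction of the unproven literals holds after the entry step, so the evaluation survives in the narrowed program). -/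

import Mathlib

/-- A program transition: source location, transition relation on valuations, target location. -/
structure Transition (L V : Type*) where
  src : L
  rel : V → V → Prop
  tgt : L

variable {L V : Type*}

/-- Evaluation step via a single transition `t`. -/
def StepT (t : Transition L V) (s s' : L × V) : Prop :=
  s.1 = t.src ∧ s'.1 = t.tgt ∧ t.rel s.2 s'.2

/-- Evaluation step via some transition of the program `P`. -/
def StepP (P : Set (Transition L V)) (s s' : L × V) : Prop :=
  ∃ t ∈ P, StepT t s s'

/-- Reflexive-transitive closure of program evaluation steps. -/
def Steps (P : Set (Transition L V)) : L × V → L × V → Prop :=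
  Relation.ReflTransGen (StepP P)

/-- `Q` is a conditional inductive invariant for the set of transitions `C`. -/
def CondInductiveInv (C : Set (Transition L V)) (Q : L → V → Prop) : Prop :=
  ∀ t ∈ C, ∀ v v' : V, Q t.src v → t.rel v v' → Q t.tgt v'

/-- `P` is safe for the assertion `(t, φ)` (w.r.t. the initial location `ℓ0`). -/
def Safe (ℓ0 : L) (P : Set (Transition L V)) (t : Transition L V) (φ : V → Prop) : Prop :=
  ∀ (v₀ : V) (sb s : L × V), Steps P (ℓ0, v₀) sb → StepT t sb s → φ s.2

/-- `P` is `(t', φ')`-conditionally safe for the assertion `(t, φ)`: every evaluation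
containing a segment `→_{t'} s' →_P^* sb →_t s` with `φ' s'.2` satisfies `φ s.2`. -/
def CondSafe (P : Set (Transition L V)) (t' : Transition L V) (φ' : V → Prop)
    (t : Transition L V) (φ : V → Prop) : Prop :=
  ∀ s₀ s' sb s : L × V, StepT t' s₀ s' → Steps P s' sb → StepT t sb s → φ' s'.2 → φ s.2

theorem CondInductiveInv.of_steps {C : Set (Transition L V)} {Q : L → V → Prop}
    (hQ : CondInductiveInv C Q) {s s' : L × V} (h : Steps C s s') (hs : Q s.1 s.2) :
    Q s'.1 s'.2 := by
  induction h with
  | refl => exact hs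
  | tail _ hstep ih =>
    obtain ⟨t, ht, hsrc, htgt, hrel⟩ := hstep
    rw [htgt]
    exact hQ t ht _ _ (hsrc ▸ ih) hrel

/-- narrowing of entry transitions preserves unsafe evaluations. -/
theorem narrowing_entries_preserves_unsafe (ℓ0 : L) (P C : Set (Transition L V))
    (hCP : C ⊆ P) (Q : L → V → Prop) (hQ : CondInductiveInv C Q)
    (texit : Transition L V) (hexitP : texit ∈ P) (hexitC : texit ∉ C)
    (φ : V → Prop)
    (hsafety : ∀ v v' : V, Q texit.src v → texit.rel v v' → φ v')
    (t : Transition L V) (htP : t ∈ P)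
    (k : ℕ) (Lit : Fin k → V → Prop)
    (hconj : ∀ v : V, Q t.tgt v ↔ ∀ i, Lit i v)
    (S : Set (Fin k)) (hS : ∀ i ∈ S, Safe ℓ0 P t (Lit i)) :
    ∀ v₀ vb v₁ v v' : V,
      Steps P (ℓ0, v₀) (t.src, vb) → t.rel vb v₁ →
      Steps C (t.tgt, v₁) (texit.src, v) → texit.rel v v' → ¬ φ v' →
      ∃ i, i ∉ S ∧ ¬ Lit i v₁ := by
  intro v₀ vb v₁ v v' hreach hentry hC hexit hφ
  by_contra! hall
  refine hφ (hsafety v v' (hQ.of_steps hC ((hconj v₁).2 fun i => ?_)) hexit)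
  by_cases hi : i ∈ S
  · exact hS i hi v₀ (t.src, vb) (t.tgt, v₁) hreach ⟨rfl, rfl, hentry⟩
  · exact hall i hi
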